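/- The output of the type quantization algorithm is well-defined: given p ∈ Ω_m, setting k'_i = ⌊n p_i + 1/2⌋ and n' = Σ k'_i, the discrepancy Δ = n' − n satisfies |Δ| ≤ m/2, and moreover if Δ > 0 then at least Δ of the k'_i are positive (so decrementing keeps all coordinates nonnegative). -/

import Mathlib

/-- Well-definedness of the type quantization algorithm: with
`k'_i = ⌊n p_i + 1/2⌋` and `Δ = (Σ k'_i) − n`, one has `|Δ| ≤ m/2`, and if
`Δ > 0` then at least `Δ` of the `k'_i` are positive. -/
theorem type_quantizer_well_defined (m n : ℕ) (hm : 1 ≤ m) (hn : 1 ≤ n)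
    (p : Fin m → ℝ) (hp0 : ∀ i, 0 ≤ p i) (hp1 : ∑ i, p i = 1)
    (k' : Fin m → ℤ) (hk' : ∀ i, k' i = ⌊(n : ℝ) * p i + 1 / 2⌋)
    (Δ : ℤ) (hΔ : Δ = (∑ i, k' i) - n) :
    |(Δ : ℝ)| ≤ (m : ℝ) / 2 ∧
    (0 < Δ → Δ ≤ (Finset.univ.filter fun i => 0 < k' i).card) := by
  have hD : (Δ : ℝ) = ∑ i, ((k' i : ℝ) - n * p i) := by
    rw [Finset.sum_sub_distrib, ← Finset.mul_sum, hp1, hΔ]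
    push_cast
    ring
  have hle : ∀ i, (k' i : ℝ) - n * p i ≤ 1 / 2 := fun i => by
    have h := Int.floor_le ((n : ℝ) * p i + 1 / 2)
    rw [← hk' i] at h
    linarith
  have hge : ∀ i, -(1 / 2) ≤ (k' i : ℝ) - n * p i := fun i => by
    have h := Int.lt_floor_add_one ((n : ℝ) * p i + 1 / 2)
    rw [← hk' i] at h
    linarith
  refine ⟨?_, fun _ => ?_⟩
  · have h1 : (Δ : ℝ) ≤ ∑ _i : Fin m, (1 / 2 : ℝ) := by
      rw [hD]
      exact Finset.sum_le_sum fun i _ => hle i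
    have h2 : ∑ _i : Fin m, (-(1 / 2) : ℝ) ≤ (Δ : ℝ) := by
      rw [hD]
      exact Finset.sum_le_sum fun i _ => hge i
    simp only [Finset.sum_const, Finset.card_univ, Fintype.card_fin, nsmul_eq_mul] at h1 h2
    rw [abs_le]
    constructor <;> linarith
  · have h : (Δ : ℝ) ≤ ∑ i, (if 0 < k' i then (1 : ℝ) else 0) := by
      rw [hD]
      refine Finset.sum_le_sum fun i _ => ?_
      split_ifs with hi
      · linarith [hle i]
      · have h0 : (k' i : ℝ) ≤ 0 := by exact_mod_cast not_lt.mp hi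
        have h3 : 0 ≤ (n : ℝ) * p i := mul_nonneg (Nat.cast_nonneg n) (hp0 i)
        linarith
    rw [Finset.sum_boole] at h
    exact_mod_cast h
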